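/- Let W be an admissible Wilson loop diagram with k propagators having a vertex i that supports no propagator, and let V be the (admissible) Wilson loop diagram obtained from W by removing vertex i. Then the Le diagram of W is obtained from the Le diagram of V by inserting an extra column consisting entirely of 0s in position i (so that the new column carries the label i). -/

import Mathlib

open scoped Classical

namespace WLD

/-- A propagator of a Wilson loop diagram on the cyclically ordered vertex set
`ZMod n` (vertex `n` is identified with `0`): an unordered pair of edges, the
edge joining vertex `i` to vertex `i+1` being labelled `i`. -/
abbrev Prp (n : ℕ) := Sym2 (ZMod n)

variable (n : ℕ)

/-- The position of `x` in the linear order `i <_i i+1 <_i ⋯ <_i i-1`. -/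
def ord (i x : ZMod n) : ℕ := (x - i).val

/-- The other end of a propagator `p` having an end on the edge `e`. -/
noncomputable def otherEnd (p : Prp n) (e : ZMod n) : ZMod n :=
  if h : e ∈ p then Sym2.Mem.other h else e

/-- The vertex support `V(p) = {i, i+1, j, j+1}` of the propagator `p = (i,j)`. -/
def supp (p : Prp n) : Finset (ZMod n) :=
  Sym2.lift ⟨fun i j => {i, i + 1, j, j + 1}, fun i j => by
    ext x
    simp only [Finset.mem_insert, Finset.mem_singleton]
    tauto⟩ p

/-- The vertex support `V(Q)` of a set of propagators. -/
def suppSet (Q : Finset (Prp n)) : Finset (ZMod n) := Q.biUnion (supp n)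

/-- `Prop(U)`: the propagators of `P` supported on (a vertex of) `U`. -/
noncomputable def propsOn (P : Finset (Prp n)) (U : Finset (ZMod n)) : Finset (Prp n) :=
  P.filter fun p => (supp n p ∩ U).Nonempty

/-- Two propagators `p = (i,j)` and `q = (k,l)` cross if `i < k < j < l` cyclically. -/
def Crossing (p q : Prp n) : Prop :=
  ∃ i j k l : ZMod n, p = s(i, j) ∧ q = s(k, l) ∧
    0 < ord n i k ∧ ord n i k < ord n i j ∧ ord n i j < ord n i l

/-- Weak admissibility of a Wilson loop diagram. -/
structure IsWeaklyAdmissible (P : Finset (Prp n)) : Prop where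
  dense : ∀ Q ⊆ P, Q.Nonempty → Q.card + 3 ≤ (suppSet n Q).card
  noncross : ∀ p ∈ P, ∀ q ∈ P, ¬ Crossing n p q

/-- Admissibility of a Wilson loop diagram. -/
structure IsAdmissible (P : Finset (Prp n)) : Prop where
  card_add_four_le : P.card + 4 ≤ n
  dense : ∀ Q ⊆ P, Q.Nonempty → Q.card + 3 ≤ (suppSet n Q).card
  noncross : ∀ p ∈ P, ∀ q ∈ P, ¬ Crossing n p q

/-- The length of a propagator `p = (i,j)`:
`min(|[i+1, j]|, |[j+1, i]|)`, the number of vertices on its smaller side. -/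
def plength (p : Prp n) : ℕ :=
  Sym2.lift ⟨fun i j => min ((j - i - 1).val + 1) ((i - j - 1).val + 1),
    fun _ _ => min_comm _ _⟩ p

/-- `InsideDir n i p q` : the propagator `q = (k,l)` lies (weakly) inside the
propagator `p = (i,j)` directed from its end `i`, i.e. `i ≤_i k <_i l ≤_i j`. -/
def InsideDir (i : ZMod n) (p q : Prp n) : Prop :=
  ∃ j k l : ZMod n, p = s(i, j) ∧ q = s(k, l) ∧
    ord n i k < ord n i l ∧ ord n i l ≤ ord n i j

/-- Sorting key measuring how far clockwise of the vertex `a` the relevant end of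
a propagator supported on `a` is attached: ends on the edge `a-1` are clockwise of
ends on the edge `a`, and on a fixed edge an end is the more clockwise the larger
the propagator is (nestedness of noncrossing propagators sharing an edge). -/
noncomputable def cwKey (a : ZMod n) (p : Prp n) : ℕ :=
  if a - 1 ∈ p then n + ord n (a - 1) (otherEnd n p (a - 1))
  else ord n a (otherEnd n p a)

/-- The clockwise-most propagator of `S` supported on the vertex `a`, if any. -/
noncomputable def pickCW (S : Finset (Prp n)) (a : ZMod n) : Option (Prp n) :=
  if h : (S.filter fun p => a ∈ supp n p).Nonempty then
    some (Classical.choose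
      ((S.filter fun p => a ∈ supp n p).exists_max_image (cwKey n a) h))
  else none

/-- The Grassmann necklace algorithm started at the vertex `i`: after `t` steps,
`(gnRun n P i t).1` is the set of propagators not yet deleted, and
`(gnRun n P i t).2` records the vertex assigned to each deleted propagator.
Step `t+1` processes the vertex `i + t`: if some not-yet-deleted propagator is
supported on it, the clockwise-most such propagator is deleted and assigned
that vertex. -/
noncomputable def gnRun (P : Finset (Prp n)) (i : ZMod n) :
    ℕ → Finset (Prp n) × (Prp n → Option (ZMod n))
  | 0 => (P, fun _ => none)
  | t + 1 =>
    match pickCW n (gnRun P i t).1 (i + (t : ZMod n)) with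
    | none => gnRun P i t
    | some p => ((gnRun P i t).1.erase p,
        Function.update (gnRun P i t).2 p (some (i + (t : ZMod n))))

/-- `I_i^W(p)`: the vertex contributed by the propagator `p` to the Grassmann
necklace term `I_i^W` (as an `Option`; the algorithm makes one full circuit of
the vertex set, i.e. runs for `n` steps). -/
noncomputable def gnAssign (P : Finset (Prp n)) (i : ZMod n) (p : Prp n) :
    Option (ZMod n) :=
  (gnRun n P i n).2 p

/-- The Grassmann necklace term `I_i^W` produced by the algorithm. -/
noncomputable def gnSet [NeZero n] (P : Finset (Prp n)) (i : ZMod n) :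
    Finset (ZMod n) :=
  Finset.univ.filter fun v => ∃ p, gnAssign n P i p = some v

/-- The cyclic interval `{a, a+1, …, a + (len-1)}` in `ZMod n`. -/
def cInterval [NeZero n] (a : ZMod n) (len : ℕ) : Finset (ZMod n) :=
  Finset.univ.filter fun x => ord n a x < len

/-- A Grassmann necklace of type `(k, n)`: a cyclic sequence of `k`-element
subsets of the vertex set such that `I_{i+1} = (I_i \ {i}) ∪ {j}` for some `j`
whenever `i ∈ I_i`, and `I_{i+1} = I_i` otherwise. -/
def IsGrassmannNecklace [NeZero n] (k : ℕ) (I : ZMod n → Finset (ZMod n)) : Prop :=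
  (∀ i, (I i).card = k) ∧
  ∀ i : ZMod n,
    (i ∈ I i → ∃ j : ZMod n, I (i + 1) = insert j ((I i).erase i)) ∧
    (i ∉ I i → I (i + 1) = I i)

/-- Independence in the matroid `M(W)`: no subset `U` of `J` supports fewer
propagators than the vertices it contains. -/
def Indep (P : Finset (Prp n)) (J : Finset (ZMod n)) : Prop :=
  ∀ U ⊆ J, U.card ≤ (propsOn n P U).card

/-- `A` is lexicographically smaller than `B` with respect to the order `<_i`:
the `<_i`-least element of the symmetric difference lies in `A`. -/
def LexLt (i : ZMod n) (A B : Finset (ZMod n)) : Prop :=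
  ∃ v, v ∈ A ∧ v ∉ B ∧ ∀ w, ord n i w < ord n i v → (w ∈ A ↔ w ∈ B)

/-- A `+` is placed in the box `(a, b)` of the Le diagram with row labels `I₁`
by the necklace term `Ii`: writing `I₁ \ Ii = {a₁ > ⋯ > a_r}` and
`Ii \ I₁ = {b₁ < ⋯ < b_r}` in the `<₁` order, the plusses are in the boxes
`(a_t, b_t)`. -/
def LePlusAt (I₁ Ii : Finset (ZMod n)) (a b : ZMod n) : Prop :=
  a ∈ I₁ \ Ii ∧ b ∈ Ii \ I₁ ∧
    ((I₁ \ Ii).filter fun x => ord n 1 a < ord n 1 x).card =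
      ((Ii \ I₁).filter fun y => ord n 1 y < ord n 1 b).card

/-- The box `(a, b)` of the Le diagram of the diagram `P` contains a `+`. -/
def LePlus [NeZero n] (P : Finset (Prp n)) (a b : ZMod n) : Prop :=
  ∃ i : ZMod n, LePlusAt n (gnSet n P 1) (gnSet n P i) a b

/-- The number of `+` entries in the Le diagram of the diagram `P`. -/
noncomputable def plusCount [NeZero n] (P : Finset (Prp n)) : ℕ :=
  (Finset.univ.filter fun ab : ZMod n × ZMod n => LePlus n P ab.1 ab.2).card

/-- The length of the row labelled `a` of the Young diagram with row labels `I₁`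
(the boxes of row `a` are indexed by the column labels `b ∉ I₁` with `a <₁ b`). -/
noncomputable def rowLen [NeZero n] (I₁ : Finset (ZMod n)) (a : ZMod n) : ℕ :=
  (Finset.univ.filter fun b => b ∉ I₁ ∧ ord n 1 a < ord n 1 b).card

/-- The entry of the matrix `C(W)` in row `p` and column `q`: the indeterminate
`x_{p,q}` if `q ∈ V(p)`, and `0` otherwise. -/
noncomputable def CW (p : Prp n) (q : ZMod n) : MvPolynomial (Prp n × ZMod n) ℝ :=
  if q ∈ supp n p then MvPolynomial.X (p, q) else 0

/-- The column paired with the row `p` in the minors determined by `I_i^W`. -/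
noncomputable def colOf (P : Finset (Prp n)) (i : ZMod n) (p : Prp n) : ZMod n :=
  (gnAssign n P i p).getD i

/-- `Δ_{I_i}`: the determinant of the `k × k` minor of `C(W)` on the columns
indexed by `I_i^W`, rows and columns paired via the necklace assignment. -/
noncomputable def Delta (P : Finset (Prp n)) (i : ZMod n) :
    MvPolynomial (Prp n × ZMod n) ℝ :=
  Matrix.det (Matrix.of fun p q : ↥P => CW n (p : Prp n) (colOf n P i (q : Prp n)))

/-- `S_i`: the propagators whose contribution changes from `I_{i-1}` to `I_i`. -/
noncomputable def Schanged (P : Finset (Prp n)) (i : ZMod n) : Finset (Prp n) :=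
  P.filter fun p => gnAssign n P (i - 1) p ≠ gnAssign n P i p

/-- `r_i`: the determinant of the minor of `C(W)` with rows indexed by `S_i` and
columns indexed by `I_i(S_i)` (equal to `1` when `S_i = ∅`). -/
noncomputable def rfac (P : Finset (Prp n)) (i : ZMod n) :
    MvPolynomial (Prp n × ZMod n) ℝ :=
  Matrix.det
    (Matrix.of fun p q : ↥(Schanged n P i) => CW n (p : Prp n) (colOf n P i (q : Prp n)))

/-- `R = ∏ᵢ rᵢ`, the polynomial produced by the algorithm. -/
noncomputable def Rpoly [NeZero n] (P : Finset (Prp n)) :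
    MvPolynomial (Prp n × ZMod n) ℝ :=
  ∏ i : ZMod n, rfac n P i

/-- Position of the end of the propagator `p` along the edge `e`: larger values
attach closer to the vertex `e`, i.e. earlier in the counterclockwise ordering
of the ends of propagators along the edge `e`. -/
noncomputable def edgeKey (e : ZMod n) (p : Prp n) : ℕ := ord n e (otherEnd n p e)

/-- The propagators of `P` with an end on the edge `e`. -/
noncomputable def onEdge (P : Finset (Prp n)) (e : ZMod n) : Finset (Prp n) :=
  P.filter fun p => e ∈ p

/-- `p` is the first propagator (`p₁`) on the edge `e` in the counterclockwise
ordering of the propagators with an end on the edge `e`. -/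
def IsCcwFirst (P : Finset (Prp n)) (e : ZMod n) (p : Prp n) : Prop :=
  p ∈ onEdge n P e ∧ ∀ q ∈ onEdge n P e, edgeKey n e q ≤ edgeKey n e p

/-- `p` is the last propagator (`p_r`) on the edge `e` in the counterclockwise
ordering of the propagators with an end on the edge `e`. -/
def IsCcwLast (P : Finset (Prp n)) (e : ZMod n) (p : Prp n) : Prop :=
  p ∈ onEdge n P e ∧ ∀ q ∈ onEdge n P e, edgeKey n e p ≤ edgeKey n e q

/-- `p` and `q` are consecutive, in this order (`p = p_j`, `q = p_{j+1}`), in the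
counterclockwise ordering of the propagators with an end on the edge `e`. -/
def ConsecOnEdge (P : Finset (Prp n)) (e : ZMod n) (p q : Prp n) : Prop :=
  p ∈ onEdge n P e ∧ q ∈ onEdge n P e ∧ edgeKey n e q < edgeKey n e p ∧
    ∀ r ∈ onEdge n P e, ¬ (edgeKey n e q < edgeKey n e r ∧ edgeKey n e r < edgeKey n e p)

/-- The factor `R_e` of the denominator `R(W)` associated to the edge `e`:
`R_e = x_{p₁,e+1} • ∏_{j=1}^{r-1} (x_{p_j,e} x_{p_{j+1},e+1} - x_{p_{j+1},e} x_{p_j,e+1}) • x_{p_r,e}`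
for the counterclockwise ordering `p₁, …, p_r` of the propagators on the edge `e`
(`R_e = 1` if there are none). -/
noncomputable def Redge (P : Finset (Prp n)) (e : ZMod n) :
    MvPolynomial (Prp n × ZMod n) ℝ :=
  (∏ p ∈ (onEdge n P e).filter (IsCcwFirst n P e), MvPolynomial.X (p, e + 1)) *
    (∏ pq ∈ (P ×ˢ P).filter (fun pq => ConsecOnEdge n P e pq.1 pq.2),
      (MvPolynomial.X (pq.1, e) * MvPolynomial.X (pq.2, e + 1) -
        MvPolynomial.X (pq.2, e) * MvPolynomial.X (pq.1, e + 1))) *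
    (∏ p ∈ (onEdge n P e).filter (IsCcwLast n P e), MvPolynomial.X (p, e))

/-- The denominator `R(W) = ∏ₑ R_e` of the integrand `Ω(W)`. -/
noncomputable def RW [NeZero n] (P : Finset (Prp n)) :
    MvPolynomial (Prp n × ZMod n) ℝ :=
  ∏ e : ZMod n, Redge n P e

/-- The relabelling map associated to the removal of the vertex `i` from the
vertex set `ZMod n`: the vertex of `ZMod (n-1)` in position `t` (in the `<₁`
order) is sent to the vertex of `ZMod n` in position `t` if `t` precedes the
position of `i`, and to the vertex in position `t+1` otherwise. -/
noncomputable def liftVert (i : ZMod n) (x : ZMod (n - 1)) : ZMod n :=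
  1 + ((if ord (n - 1) 1 x < ord n 1 i then ord (n - 1) 1 x
        else ord (n - 1) 1 x + 1 : ℕ) : ZMod n)

end WLD
namespace WLD

section Order

lemma ord_add_natCast {n : ℕ} (a : ZMod n) {t : ℕ} (ht : t < n) :
    ord n a (a + (t : ZMod n)) = t := by
  simp [ord, ZMod.val_natCast, Nat.mod_eq_of_lt ht]

variable {n : ℕ} [NeZero n]

lemma ord_lt (a x : ZMod n) : ord n a x < n := ZMod.val_lt _

lemma add_ord (a x : ZMod n) : a + (ord n a x : ZMod n) = x := by
  simp [ord]

lemma ord_right_injective (a : ZMod n) : Function.Injective (ord n a) := by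
  intro x y h
  rw [← add_ord a x, ← add_ord a y, h]

/-- Positions relative to `a` in terms of positions relative to `b`. -/
lemma ord_eq_ite (b a x : ZMod n) :
    ord n a x = if ord n b a ≤ ord n b x then ord n b x - ord n b a
      else ord n b x + n - ord n b a := by
  have ha := ord_lt b a
  have hx := ord_lt b x
  have key : ∀ t : ℕ, t < n → ((ord n b a + t : ℕ) : ZMod n) = (ord n b x : ZMod n) →
      ord n a x = t := by
    intro t ht h
    have : x = a + (t : ZMod n) := by
      conv_lhs => rw [← add_ord b x, ← h, Nat.cast_add, ← add_assoc, add_ord]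
    rw [this, ord_add_natCast a ht]
  split_ifs with h
  · exact key _ (by omega) (by congr 1; omega)
  · refine key _ (by omega) ?_
    rw [show ord n b a + (ord n b x + n - ord n b a) = ord n b x + n by omega]
    simp

end Order

section Support

variable {n : ℕ}

lemma mem_supp_iff {p : Prp n} {a : ZMod n} : a ∈ supp n p ↔ a ∈ p ∨ a - 1 ∈ p := by
  induction p using Sym2.ind with
  | h x y =>
    simp only [supp, Sym2.lift_mk, Finset.mem_insert, Finset.mem_singleton, Sym2.mem_iff,
      sub_eq_iff_eq_add]
    tauto

lemma mk_otherEnd {p : Prp n} {e : ZMod n} (h : e ∈ p) : s(e, otherEnd n p e) = p := by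
  rw [otherEnd, dif_pos h, Sym2.other_spec]

lemma cwKey_of_sub_one_mem {p : Prp n} {a : ZMod n} (h : a - 1 ∈ p) :
    cwKey n a p = n + ord n (a - 1) (otherEnd n p (a - 1)) := if_pos h

lemma cwKey_of_sub_one_notMem {p : Prp n} {a : ZMod n} (h : a - 1 ∉ p) :
    cwKey n a p = ord n a (otherEnd n p a) := if_neg h

lemma cwKey_injOn [NeZero n] {p q : Prp n} {a : ZMod n} (hp : a ∈ supp n p)
    (hq : a ∈ supp n q) (h : cwKey n a p = cwKey n a q) : p = q := by
  rw [mem_supp_iff] at hp hq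
  have key : ∀ e : ZMod n, e ∈ p → e ∈ q →
      ord n e (otherEnd n p e) = ord n e (otherEnd n q e) → p = q := by
    intro e hep heq he
    rw [← mk_otherEnd hep, ← mk_otherEnd heq, ord_right_injective e he]
  by_cases h1 : a - 1 ∈ p <;> by_cases h2 : a - 1 ∈ q
  · rw [cwKey_of_sub_one_mem h1, cwKey_of_sub_one_mem h2] at h
    exact key _ h1 h2 (by omega)
  · rw [cwKey_of_sub_one_mem h1, cwKey_of_sub_one_notMem h2] at h
    have := ord_lt a (otherEnd n q a)
    omega
  · rw [cwKey_of_sub_one_notMem h1, cwKey_of_sub_one_mem h2] at h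
    have := ord_lt a (otherEnd n p a)
    omega
  · rw [cwKey_of_sub_one_notMem h1, cwKey_of_sub_one_notMem h2] at h
    exact key _ (hp.resolve_right h1) (hq.resolve_right h2) h

lemma pickCW_eq_none_iff {S : Finset (Prp n)} {a : ZMod n} :
    pickCW n S a = none ↔ ∀ p ∈ S, a ∉ supp n p := by
  unfold pickCW
  split_ifs with h
  · obtain ⟨p, hp⟩ := h
    rw [Finset.mem_filter] at hp
    simpa using ⟨p, hp⟩
  · rw [Finset.not_nonempty_iff_eq_empty, Finset.filter_eq_empty_iff] at h
    simpa using h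

lemma pickCW_eq_some_iff [NeZero n] {S : Finset (Prp n)} {a : ZMod n} {p : Prp n} :
    pickCW n S a = some p ↔ p ∈ S ∧ a ∈ supp n p ∧
      ∀ q ∈ S, a ∈ supp n q → cwKey n a q ≤ cwKey n a p := by
  unfold pickCW
  split_ifs with h
  · have hc := Classical.choose_spec
      ((S.filter fun p => a ∈ supp n p).exists_max_image (cwKey n a) h)
    set c := Classical.choose
      ((S.filter fun p => a ∈ supp n p).exists_max_image (cwKey n a) h)
    simp only [Finset.mem_filter] at hc
    obtain ⟨⟨hcS, hca⟩, hmax⟩ := hc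
    rw [Option.some.injEq]
    constructor
    · rintro rfl
      exact ⟨hcS, hca, fun q hq hqa => hmax q ⟨hq, hqa⟩⟩
    · rintro ⟨hp, hpa, hp_max⟩
      exact cwKey_injOn hca hpa (le_antisymm (hp_max _ hcS hca) (hmax _ ⟨hp, hpa⟩))
  · simp only [false_iff]
    rintro ⟨hp, hpa, -⟩
    exact h ⟨p, Finset.mem_filter.2 ⟨hp, hpa⟩⟩

end Support

lemma liftVert_one_eq_one {n : ℕ} [NeZero n] {i : ZMod n} (hi : i ≠ 1) : liftVert n i 1 = 1 := by
  have h0 : ord n 1 i ≠ 0 := by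
    intro h0
    have := add_ord 1 i
    exact hi (by simpa [h0] using this.symm)
  have h1 : ord (n - 1) 1 1 = 0 := by simp [ord]
  rw [liftVert, h1, if_pos (by omega), Nat.cast_zero, add_zero]

lemma liftVert_one_one (n : ℕ) : liftVert n 1 1 = 1 + 1 := by
  simp [liftVert, ord]

section LiftVert

variable {n : ℕ} [NeZero (n - 1)] {i : ZMod n}

lemma ord_one_liftVert (x : ZMod (n - 1)) :
    ord n 1 (liftVert n i x) =
      if ord (n - 1) 1 x < ord n 1 i then ord (n - 1) 1 x else ord (n - 1) 1 x + 1 := by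
  have hx := ord_lt 1 x
  exact ord_add_natCast 1 (by split_ifs <;> omega)

lemma liftVert_injective : Function.Injective (liftVert n i) := by
  intro x y h
  have h1 := ord_one_liftVert (i := i) x
  rw [h, ord_one_liftVert] at h1
  apply ord_right_injective 1
  split_ifs at h1 <;> omega

lemma liftVert_ne (x : ZMod (n - 1)) : liftVert n i x ≠ i := by
  intro h
  have h1 := ord_one_liftVert (i := i) x
  rw [h] at h1
  split_ifs at h1 <;> omega

lemma ord_one_liftVert_lt_iff {x y : ZMod (n - 1)} :
    ord n 1 (liftVert n i x) < ord n 1 (liftVert n i y) ↔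
      ord (n - 1) 1 x < ord (n - 1) 1 y := by
  rw [ord_one_liftVert, ord_one_liftVert]
  split_ifs <;> omega

variable [NeZero n]

/-- The relabelling skips exactly the vertex `i`, seen from any base vertex. -/
lemma ord_liftVert (a x : ZMod (n - 1)) :
    ord n (liftVert n i a) (liftVert n i x) =
      if ord (n - 1) a x < ord n (liftVert n i a) i then ord (n - 1) a x
      else ord (n - 1) a x + 1 := by
  have ha := ord_lt 1 a
  have hx := ord_lt 1 x
  have hi := ord_lt 1 i
  rw [ord_eq_ite 1 (liftVert n i a) (liftVert n i x), ord_eq_ite 1 (liftVert n i a) i,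
    ord_eq_ite 1 a x, ord_one_liftVert, ord_one_liftVert]
  split_ifs <;> omega

lemma exists_liftVert_eq {a : ZMod n} (ha : a ≠ i) : ∃ x, liftVert n i x = a := by
  have hne : ord n 1 a ≠ ord n 1 i := fun h => ha (ord_right_injective 1 h)
  have ha' := ord_lt 1 a
  have hi := ord_lt 1 i
  have h0 := NeZero.pos (n - 1)
  refine ⟨1 + ((if ord n 1 a < ord n 1 i then ord n 1 a else ord n 1 a - 1 : ℕ) : ZMod (n - 1)),
    ord_right_injective 1 ?_⟩
  rw [ord_one_liftVert, ord_add_natCast 1 (by split_ifs <;> omega)]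
  split_ifs <;> omega

lemma liftVert_add_natCast (a : ZMod (n - 1)) {t : ℕ} (ht : t < n - 1) :
    liftVert n i (a + (t : ZMod (n - 1))) = liftVert n i a +
      ((if t < ord n (liftVert n i a) i then t else t + 1 : ℕ) : ZMod n) := by
  have h := ord_liftVert (i := i) a (a + (t : ZMod (n - 1)))
  rw [ord_add_natCast a ht] at h
  rw [← h, add_ord]

lemma liftVert_add_one (hn : 3 ≤ n) {e : ZMod (n - 1)} (he : liftVert n i e + 1 ≠ i) :
    liftVert n i (e + 1) = liftVert n i e + 1 := by
  have h := liftVert_add_natCast (i := i) e (t := 1) (by omega)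
  rw [Nat.cast_one] at h
  have h0 : ord n (liftVert n i e) i ≠ 0 := by
    intro h0
    apply liftVert_ne e
    have := add_ord (liftVert n i e) i
    simpa [h0] using this
  have h1 : ord n (liftVert n i e) i ≠ 1 := by
    intro h1
    apply he
    have := add_ord (liftVert n i e) i
    simpa [h1] using this
  rw [h, if_pos (by omega), Nat.cast_one]

lemma ord_liftVert_mono {a x y : ZMod (n - 1)} (h : ord (n - 1) a x ≤ ord (n - 1) a y) :
    ord n (liftVert n i a) (liftVert n i x) ≤ ord n (liftVert n i a) (liftVert n i y) := by
  rw [ord_liftVert, ord_liftVert]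
  split_ifs <;> omega

end LiftVert

section Propagators

variable {n : ℕ} [NeZero (n - 1)] {i : ZMod n}

lemma map_liftVert_injective : Function.Injective (Sym2.map (liftVert n i)) :=
  Sym2.map.injective liftVert_injective

lemma liftVert_mem_map_iff {p : Prp (n - 1)} {a : ZMod (n - 1)} :
    liftVert n i a ∈ Sym2.map (liftVert n i) p ↔ a ∈ p := by
  rw [Sym2.mem_map]
  constructor
  · rintro ⟨e, he, h⟩
    rwa [← liftVert_injective h]
  · exact fun h => ⟨a, h, rfl⟩

lemma otherEnd_map {p : Prp (n - 1)} {e : ZMod (n - 1)} (h : e ∈ p) :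
    otherEnd n (Sym2.map (liftVert n i) p) (liftVert n i e) =
      liftVert n i (otherEnd (n - 1) p e) := by
  have h1 := mk_otherEnd (liftVert_mem_map_iff (i := i).2 h)
  conv_rhs at h1 => rw [← mk_otherEnd h, Sym2.map_mk]
  exact Sym2.congr_right.1 h1

variable [NeZero n] {p q : Prp (n - 1)}

lemma liftVert_add_one_of_mem (hn : 3 ≤ n) (hp : i ∉ supp n (Sym2.map (liftVert n i) p))
    {e : ZMod (n - 1)} (he : e ∈ p) : liftVert n i (e + 1) = liftVert n i e + 1 := by
  refine liftVert_add_one hn fun h => hp (mem_supp_iff.2 (Or.inr ?_))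
  rw [← eq_sub_of_add_eq h]
  exact liftVert_mem_map_iff.2 he

lemma liftVert_sub_one_mem_map_iff (hn : 3 ≤ n)
    (hp : i ∉ supp n (Sym2.map (liftVert n i) p)) {a : ZMod (n - 1)} :
    liftVert n i a - 1 ∈ Sym2.map (liftVert n i) p ↔ a - 1 ∈ p := by
  constructor
  · intro h
    obtain ⟨e, he, h⟩ := Sym2.mem_map.1 h
    rw [eq_sub_iff_add_eq, ← liftVert_add_one_of_mem hn hp he] at h
    rwa [← liftVert_injective h, add_sub_cancel_right]
  · intro h
    have h1 := liftVert_add_one_of_mem hn hp h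
    rw [sub_add_cancel] at h1
    rw [h1, add_sub_cancel_right]
    exact liftVert_mem_map_iff.2 h

lemma liftVert_sub_one (hn : 3 ≤ n) (hp : i ∉ supp n (Sym2.map (liftVert n i) p))
    {a : ZMod (n - 1)} (h : a - 1 ∈ p) : liftVert n i a - 1 = liftVert n i (a - 1) := by
  have h1 := liftVert_add_one_of_mem hn hp h
  rw [sub_add_cancel] at h1
  rw [h1, add_sub_cancel_right]

lemma liftVert_mem_supp_map_iff (hn : 3 ≤ n) (hp : i ∉ supp n (Sym2.map (liftVert n i) p))
    {a : ZMod (n - 1)} :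
    liftVert n i a ∈ supp n (Sym2.map (liftVert n i) p) ↔ a ∈ supp (n - 1) p := by
  rw [mem_supp_iff, mem_supp_iff, liftVert_mem_map_iff, liftVert_sub_one_mem_map_iff hn hp]

lemma cwKey_map_mono (hn : 3 ≤ n) (hp : i ∉ supp n (Sym2.map (liftVert n i) p))
    (hq : i ∉ supp n (Sym2.map (liftVert n i) q)) {a : ZMod (n - 1)}
    (hpa : a ∈ supp (n - 1) p) (hqa : a ∈ supp (n - 1) q)
    (h : cwKey (n - 1) a p ≤ cwKey (n - 1) a q) :
    cwKey n (liftVert n i a) (Sym2.map (liftVert n i) p) ≤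
      cwKey n (liftVert n i a) (Sym2.map (liftVert n i) q) := by
  rw [mem_supp_iff] at hpa hqa
  have hp' := liftVert_sub_one_mem_map_iff hn hp (a := a)
  have hq' := liftVert_sub_one_mem_map_iff hn hq (a := a)
  by_cases h1 : a - 1 ∈ p <;> by_cases h2 : a - 1 ∈ q
  · rw [cwKey_of_sub_one_mem h1, cwKey_of_sub_one_mem h2] at h
    rw [cwKey_of_sub_one_mem (hp'.2 h1), cwKey_of_sub_one_mem (hq'.2 h2),
      liftVert_sub_one hn hp h1, otherEnd_map h1, otherEnd_map h2]
    exact Nat.add_le_add_left (ord_liftVert_mono (by omega)) _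
  · rw [cwKey_of_sub_one_mem h1, cwKey_of_sub_one_notMem h2] at h
    have := ord_lt a (otherEnd (n - 1) q a)
    omega
  · rw [cwKey_of_sub_one_notMem (mt hp'.1 h1), cwKey_of_sub_one_mem (hq'.2 h2)]
    exact (ord_lt _ _).le.trans (Nat.le_add_right _ _)
  · rw [cwKey_of_sub_one_notMem h1, cwKey_of_sub_one_notMem h2] at h
    rw [cwKey_of_sub_one_notMem (mt hp'.1 h1), cwKey_of_sub_one_notMem (mt hq'.1 h2),
      otherEnd_map (hpa.resolve_right h1), otherEnd_map (hqa.resolve_right h2)]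
    exact ord_liftVert_mono h

lemma pickCW_image_map (hn : 3 ≤ n) {S : Finset (Prp (n - 1))}
    (hS : ∀ p ∈ S, i ∉ supp n (Sym2.map (liftVert n i) p)) (a : ZMod (n - 1)) :
    pickCW n (S.image (Sym2.map (liftVert n i))) (liftVert n i a) =
      (pickCW (n - 1) S a).map (Sym2.map (liftVert n i)) := by
  cases h : pickCW (n - 1) S a with
  | none =>
    rw [pickCW_eq_none_iff] at h
    rw [Option.map_none, pickCW_eq_none_iff, Finset.forall_mem_image]
    exact fun p hp hpa => h p hp ((liftVert_mem_supp_map_iff hn (hS p hp)).1 hpa)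
  | some p =>
    rw [pickCW_eq_some_iff] at h
    obtain ⟨hp, hpa, hmax⟩ := h
    rw [Option.map_some, pickCW_eq_some_iff, Finset.forall_mem_image]
    refine ⟨Finset.mem_image_of_mem _ hp, (liftVert_mem_supp_map_iff hn (hS p hp)).2 hpa,
      fun q hq hqa => ?_⟩
    have hqa' := (liftVert_mem_supp_map_iff hn (hS q hq)).1 hqa
    exact cwKey_map_mono hn (hS q hq) (hS p hp) hqa' hpa (hmax q hq hqa')

end Propagators

section Run

variable {n : ℕ}

lemma gnRun_succ_of_none {P : Finset (Prp n)} {a : ZMod n} {t : ℕ}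
    (h : pickCW n (gnRun n P a t).1 (a + (t : ZMod n)) = none) :
    gnRun n P a (t + 1) = gnRun n P a t := by
  rw [gnRun, h]

lemma gnRun_succ_of_some {P : Finset (Prp n)} {a : ZMod n} {t : ℕ} {p : Prp n}
    (h : pickCW n (gnRun n P a t).1 (a + (t : ZMod n)) = some p) :
    gnRun n P a (t + 1) = ((gnRun n P a t).1.erase p,
      Function.update (gnRun n P a t).2 p (some (a + (t : ZMod n)))) := by
  rw [gnRun, h]

lemma gnRun_fst_subset (P : Finset (Prp n)) (a : ZMod n) (t : ℕ) :
    (gnRun n P a t).1 ⊆ P := by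
  induction t with
  | zero => exact subset_rfl
  | succ t ih =>
    cases h : pickCW n (gnRun n P a t).1 (a + (t : ZMod n)) with
    | none => rwa [gnRun_succ_of_none h]
    | some p =>
      rw [gnRun_succ_of_some h]
      exact (Finset.erase_subset _ _).trans ih

lemma gnRun_succ_of_nonsupporting {P : Finset (Prp n)} {a : ZMod n} {t : ℕ}
    (h : ∀ p ∈ P, a + (t : ZMod n) ∉ supp n p) :
    gnRun n P a (t + 1) = gnRun n P a t :=
  gnRun_succ_of_none (pickCW_eq_none_iff.2 fun p hp => h p (gnRun_fst_subset P a t hp))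

/-- A nonsupporting starting vertex can be skipped. -/
lemma gnRun_succ_eq_gnRun_add_one {P : Finset (Prp n)} {i : ZMod n}
    (h : ∀ p ∈ P, i ∉ supp n p) (t : ℕ) : gnRun n P i (t + 1) = gnRun n P (i + 1) t := by
  induction t with
  | zero => exact gnRun_succ_of_nonsupporting (by simpa using h)
  | succ t ih =>
    have hv : i + ((t + 1 : ℕ) : ZMod n) = i + 1 + (t : ZMod n) := by
      push_cast
      ring
    rw [gnRun.eq_2 n P i (t + 1), gnRun.eq_2 n P (i + 1) t, hv, ih]

lemma mem_gnSet_iff [NeZero n] {P : Finset (Prp n)} {a v : ZMod n} :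
    v ∈ gnSet n P a ↔ ∃ p, (gnRun n P a n).2 p = some v := by
  rw [gnSet, Finset.mem_filter]
  simp [gnAssign]

lemma gnSet_add_one_of_nonsupporting [NeZero n] {P : Finset (Prp n)} {i : ZMod n}
    (h : ∀ p ∈ P, i ∉ supp n p) : gnSet n P (i + 1) = gnSet n P i := by
  have hn := NeZero.pos n
  have hrun : gnRun n P (i + 1) n = gnRun n P i n := by
    obtain ⟨m, hm⟩ : ∃ m, n = m + 1 := ⟨n - 1, by omega⟩
    have hv : i + 1 + (m : ZMod n) = i := by
      have : ((m + 1 : ℕ) : ZMod n) = 0 := by rw [← hm, ZMod.natCast_self]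
      push_cast at this
      linear_combination this
    have h1 : gnRun n P (i + 1) (m + 1) = gnRun n P i (m + 1) := by
      rw [gnRun_succ_eq_gnRun_add_one h, gnRun_succ_of_nonsupporting (by rwa [hv])]
    rwa [← hm] at h1
  ext v
  rw [mem_gnSet_iff, mem_gnSet_iff, hrun]

end Run

section Relabel

variable {n : ℕ} {i : ZMod n}

/-- The state `s` of the algorithm is the relabelling of the state `s'`. -/
structure IsRelabelling (i : ZMod n) (s : Finset (Prp n) × (Prp n → Option (ZMod n)))
    (s' : Finset (Prp (n - 1)) × (Prp (n - 1) → Option (ZMod (n - 1)))) : Prop where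
  fst_eq : s.1 = s'.1.image (Sym2.map (liftVert n i))
  snd_map : ∀ p, s.2 (Sym2.map (liftVert n i) p) = (s'.2 p).map (liftVert n i)
  mem_range : ∀ p v, s.2 p = some v → p ∈ Set.range (Sym2.map (liftVert n i))

variable [NeZero (n - 1)]

lemma lePlusAt_image_iff {I J : Finset (ZMod (n - 1))} {a b : ZMod (n - 1)} :
    LePlusAt n (I.image (liftVert n i)) (J.image (liftVert n i))
      (liftVert n i a) (liftVert n i b) ↔ LePlusAt (n - 1) I J a b := by
  have hinj := liftVert_injective (i := i)
  have hmem : ∀ (S : Finset (ZMod (n - 1))) (x), liftVert n i x ∈ S.image (liftVert n i) ↔ x ∈ S :=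
    fun S x => hinj.mem_finset_image
  simp only [LePlusAt, ← Finset.image_sdiff _ _ hinj, hmem, Finset.filter_image,
    ord_one_liftVert_lt_iff, Finset.card_image_of_injective _ hinj]

variable [NeZero n] {Q : Finset (Prp (n - 1))}

lemma IsRelabelling.gnRun_succ (hn : 3 ≤ n)
    (hQ : ∀ p ∈ Q, i ∉ supp n (Sym2.map (liftVert n i) p)) {P : Finset (Prp n)} {b : ZMod n}
    {a : ZMod (n - 1)} {r t : ℕ} (h : IsRelabelling i (gnRun n P b r) (gnRun (n - 1) Q a t))
    (hv : b + (r : ZMod n) = liftVert n i (a + (t : ZMod (n - 1)))) :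
    IsRelabelling i (gnRun n P b (r + 1)) (gnRun (n - 1) Q a (t + 1)) := by
  have hpick := pickCW_image_map hn (fun p hp => hQ p (gnRun_fst_subset Q a t hp))
    (a + (t : ZMod (n - 1)))
  rw [← h.fst_eq, ← hv] at hpick
  cases hp : pickCW (n - 1) (gnRun (n - 1) Q a t).1 (a + (t : ZMod (n - 1))) with
  | none =>
    rw [hp, Option.map_none] at hpick
    rwa [gnRun_succ_of_none hp, gnRun_succ_of_none hpick]
  | some p =>
    rw [hp, Option.map_some] at hpick
    rw [gnRun_succ_of_some hp, gnRun_succ_of_some hpick]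
    refine ⟨?_, fun q => ?_, fun q v hqv => ?_⟩
    · rw [h.fst_eq, Finset.image_erase map_liftVert_injective]
    · by_cases hqp : q = p
      · subst hqp
        simp [hv]
      · have := map_liftVert_injective (i := i).ne hqp
        simp only [Function.update_of_ne this, Function.update_of_ne hqp, h.snd_map]
    · by_cases hqp : q = Sym2.map (liftVert n i) p
      · exact ⟨p, hqp.symm⟩
      · exact h.mem_range q v (by simpa only [Function.update_of_ne hqp] using hqv)

lemma isRelabelling_gnRun (hn : 3 ≤ n)
    (hQ : ∀ p ∈ Q, i ∉ supp n (Sym2.map (liftVert n i) p)) (a : ZMod (n - 1)) {t : ℕ}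
    (ht : t ≤ n - 1) :
    IsRelabelling i (gnRun n (Q.image (Sym2.map (liftVert n i))) (liftVert n i a)
      (if t < ord n (liftVert n i a) i then t else t + 1)) (gnRun (n - 1) Q a t) := by
  have hskip : gnRun n (Q.image (Sym2.map (liftVert n i))) (liftVert n i a)
      (ord n (liftVert n i a) i + 1) = gnRun n (Q.image (Sym2.map (liftVert n i)))
      (liftVert n i a) (ord n (liftVert n i a) i) := by
    refine gnRun_succ_of_nonsupporting ?_
    rw [add_ord, Finset.forall_mem_image]
    exact hQ
  induction t with
  | zero =>
    have h0 : ord n (liftVert n i a) i ≠ 0 := by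
      intro h0
      have := add_ord (liftVert n i a) i
      exact liftVert_ne a (by simpa [h0] using this)
    rw [if_pos (by omega)]
    exact ⟨rfl, fun p => rfl, fun p v h => by cases h⟩
  | succ t ih =>
    have h := (ih (by omega)).gnRun_succ hn hQ (liftVert_add_natCast a (by omega)).symm
    by_cases h1 : t + 1 < ord n (liftVert n i a) i
    · rwa [if_pos (by omega)] at h ⊢
    · rw [if_neg h1]
      by_cases h2 : t < ord n (liftVert n i a) i
      · rw [if_pos h2] at h
        have h3 : ord n (liftVert n i a) i = t + 1 := by omega
        rw [h3] at hskip
        rwa [hskip]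
      · rwa [if_neg h2] at h

lemma gnSet_liftVert (hn : 3 ≤ n)
    (hQ : ∀ p ∈ Q, i ∉ supp n (Sym2.map (liftVert n i) p)) (a : ZMod (n - 1)) :
    gnSet n (Q.image (Sym2.map (liftVert n i))) (liftVert n i a) =
      (gnSet (n - 1) Q a).image (liftVert n i) := by
  have h := isRelabelling_gnRun hn hQ a le_rfl
  have hi := ord_lt (liftVert n i a) i
  rw [if_neg (by omega), Nat.sub_add_cancel (by omega)] at h
  ext v
  simp only [Finset.mem_image, mem_gnSet_iff]
  constructor
  · rintro ⟨p, hp⟩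
    obtain ⟨p, rfl⟩ := h.mem_range p v hp
    rw [h.snd_map, Option.map_eq_some_iff] at hp
    obtain ⟨x, hx, rfl⟩ := hp
    exact ⟨x, ⟨p, hx⟩, rfl⟩
  · rintro ⟨x, ⟨p, hx⟩, rfl⟩
    exact ⟨Sym2.map (liftVert n i) p, by rw [h.snd_map, hx, Option.map_some]⟩

end Relabel

/-- removing a non-supporting vertex inserts a zero column.
Let `W` be an admissible Wilson loop diagram with `k` propagators having a
vertex `i` that supports no propagator, and let `V` (here the diagram `Q` on
the vertex set `ZMod (n-1)`) be the Wilson loop diagram obtained from `W` by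
removing the vertex `i`, so that the propagators of `W` are exactly the images
of the propagators of `V` under the relabelling map `liftVert n i`.  Then the
Le diagram of `W` is obtained from the Le diagram of `V` by inserting an extra
column consisting entirely of `0`s in position `i` (so the new column carries
the label `i`): the row labels of `W` are the relabelled row labels of `V`,
`i` labels a column, and the `+` entries correspond under the relabelling, with
no `+` in the column labelled `i`. -/
theorem leDiagram_of_remove_nonsupporting_vertex
    (n : ℕ) [NeZero n] [NeZero (n - 1)]
    (P : Finset (Prp n)) (Q : Finset (Prp (n - 1))) (i : ZMod n)
    (hadm : IsAdmissible n P)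
    (hns : ∀ p ∈ P, i ∉ supp n p)
    (hrel : P = Q.image (Sym2.map (liftVert n i))) :
    i ∉ gnSet n P 1 ∧
    gnSet n P 1 = (gnSet (n - 1) Q 1).image (liftVert n i) ∧
    ∀ a b : ZMod n, LePlus n P a b ↔
      ∃ a' b' : ZMod (n - 1), a = liftVert n i a' ∧ b = liftVert n i b' ∧
        LePlus (n - 1) Q a' b' := by
  have hn : 3 ≤ n := by
    have := hadm.card_add_four_le
    omega
  subst hrel
  have hQ : ∀ p ∈ Q, i ∉ supp n (Sym2.map (liftVert n i) p) :=
    fun p hp => hns _ (Finset.mem_image_of_mem _ hp)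
  have hfirst : gnSet n (Q.image (Sym2.map (liftVert n i))) 1 =
      (gnSet (n - 1) Q 1).image (liftVert n i) := by
    rw [← gnSet_liftVert hn hQ]
    by_cases hi : i = 1
    · subst hi
      rw [liftVert_one_one, gnSet_add_one_of_nonsupporting hns]
    · rw [liftVert_one_eq_one hi]
  have hne : i + 1 ≠ i := by
    have : Fact (1 < n) := ⟨by omega⟩
    simp
  have hterm : ∀ j : ZMod n, ∃ j' : ZMod (n - 1),
      gnSet n (Q.image (Sym2.map (liftVert n i))) j =
        (gnSet (n - 1) Q j').image (liftVert n i) := by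
    intro j
    by_cases hj : j = i
    · subst hj
      obtain ⟨j', hj'⟩ := exists_liftVert_eq hne
      exact ⟨j', by rw [← gnSet_liftVert hn hQ, hj', gnSet_add_one_of_nonsupporting hns]⟩
    · obtain ⟨j', rfl⟩ := exists_liftVert_eq hj
      exact ⟨j', gnSet_liftVert hn hQ j'⟩
  refine ⟨?_, hfirst, fun a b => ⟨?_, ?_⟩⟩
  · rw [hfirst, Finset.mem_image]
    rintro ⟨x, -, hx⟩
    exact liftVert_ne x hx
  · rintro ⟨j, hj⟩
    obtain ⟨j', hj'⟩ := hterm j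
    rw [hfirst, hj'] at hj
    obtain ⟨a', -, rfl⟩ := Finset.mem_image.1 (Finset.mem_sdiff.1 hj.1).1
    obtain ⟨b', -, rfl⟩ := Finset.mem_image.1 (Finset.mem_sdiff.1 hj.2.1).1
    exact ⟨a', b', rfl, rfl, j', lePlusAt_image_iff.1 hj⟩
  · rintro ⟨a', b', rfl, rfl, j', hj⟩
    refine ⟨liftVert n i j', ?_⟩
    rw [hfirst, gnSet_liftVert hn hQ]
    exact lePlusAt_image_iff.2 hj

end WLD
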